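/- Let 1 < β < 2, let θ_k = 2^{−β} binom(β,k), let t > 0, and let g : [0,t] → ℝ be continuously differentiable. Then lim_{n→∞} ∑_{k=0}^{n} θ_{n−k} g(k t/n) = g(t). -/

import Mathlib

/-- The generalized binomial coefficient `binom(β,k) = β(β−1)⋯(β−k+1)/k!`. -/
noncomputable def gbinom (β : ℝ) (k : ℕ) : ℝ :=
  (∏ i ∈ Finset.range k, (β - i)) / (Nat.factorial k)

/-- `gbinom` agrees with Mathlib's `Ring.choose`. -/
theorem gbinom_eq_choose (β : ℝ) (k : ℕ) : gbinom β k = Ring.choose β k := by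
  rw [Ring.choose_eq_smul, ← Polynomial.aeval_eq_smeval, Polynomial.aeval_def,
    ← Polynomial.eval_map, descPochhammer_map, descPochhammer_eval_eq_prod_range, gbinom,
    smul_eq_mul, div_eq_inv_mul]

theorem gbinom_succ (β : ℝ) (k : ℕ) :
    ((k : ℝ) + 1) * gbinom β (k + 1) = (β - k) * gbinom β k := by
  have h : (Nat.factorial k : ℝ) ≠ 0 := by positivity
  rw [gbinom, gbinom, Finset.prod_range_succ, Nat.factorial_succ]
  push_cast
  field_simp

/-- For `β ≤ k` the terms `β |binom(β,k)|` telescope. -/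
theorem mul_abs_gbinom {β : ℝ} {k : ℕ} (hk : β ≤ k) :
    β * |gbinom β k| = k * |gbinom β k| - ((k : ℝ) + 1) * |gbinom β (k + 1)| := by
  have h := congrArg abs (gbinom_succ β k)
  rw [abs_mul, abs_mul, abs_of_nonneg (by positivity : (0 : ℝ) ≤ (k : ℝ) + 1),
    abs_of_nonpos (sub_nonpos.mpr hk)] at h
  rw [h]
  ring

theorem summable_abs_gbinom {β : ℝ} (hβ : 0 < β) : Summable fun k => |gbinom β k| := by
  obtain ⟨K, hK⟩ := exists_nat_ge β
  rw [← summable_nat_add_iff K, ← summable_mul_left_iff hβ.ne']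
  refine summable_of_sum_range_le (c := K * |gbinom β K|) (fun n => by positivity) fun n => ?_
  have hsum : ∑ i ∈ Finset.range n, β * |gbinom β (i + K)| =
      K * |gbinom β K| - ((n + K : ℕ) : ℝ) * |gbinom β (n + K)| := by
    induction n with
    | zero => simp
    | succ n ih =>
      have hle : β ≤ ((n + K : ℕ) : ℝ) := hK.trans (by exact_mod_cast Nat.le_add_left K n)
      rw [Finset.sum_range_succ, ih, mul_abs_gbinom hle, Nat.add_right_comm n 1 K]
      push_cast
      ring
  rw [hsum]
  exact sub_le_self _ (by positivity)

theorem hasSum_gbinom_mul_pow (β : ℝ) {x : ℝ} (hx : |x| < 1) :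
    HasSum (fun k => gbinom β k * x ^ k) ((1 + x) ^ β) := by
  have hmem : x ∈ Metric.eball (0 : ℝ) 1 := by
    rw [← ENNReal.ofReal_one, Metric.eball_ofReal, mem_ball_zero_iff]
    exact hx
  have h := (Real.one_add_rpow_hasFPowerSeriesOnBall_zero (a := β)).hasSum hmem
  simpa [binomialSeries, gbinom_eq_choose, mul_comm] using h

/-- The binomial series at `1`, by Abel's limit theorem. -/
theorem tsum_gbinom {β : ℝ} (hβ : 0 < β) : ∑' k, gbinom β k = 2 ^ β := by
  have habel := Real.tendsto_tsum_powerSeries_nhdsWithin_lt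
    (summable_abs_gbinom hβ).of_abs.hasSum.tendsto_sum_nat
  have hcont : Filter.Tendsto (fun x : ℝ => (1 + x) ^ β) (nhdsWithin 1 (Set.Iio 1))
      (nhds (2 ^ β)) := by
    have h : ContinuousAt (fun x : ℝ => (1 + x) ^ β) 1 :=
      (continuousAt_const.add continuousAt_id).rpow_const (Or.inr hβ.le)
    have h' := h.tendsto.mono_left (nhdsWithin_le_nhds (s := Set.Iio 1))
    norm_num at h'
    exact h'
  refine tendsto_nhds_unique habel (hcont.congr' ?_)
  filter_upwards [Ioo_mem_nhdsLT (show (0 : ℝ) < 1 by norm_num)] with x hx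
  exact (hasSum_gbinom_mul_pow β (abs_lt.mpr ⟨by linarith [hx.1], hx.2⟩)).tsum_eq.symm

/-- Convolving samples of a continuous function with a summable sequence of weights
recovers, in the limit, the endpoint value times the total weight. -/
theorem tendsto_sum_range_reflect_mul {θ : ℕ → ℝ} (hθ : Summable fun k => |θ k|) {t : ℝ}
    (ht : 0 ≤ t) {g : ℝ → ℝ} (hg : ContinuousOn g (Set.Icc 0 t)) :
    Filter.Tendsto
      (fun n : ℕ => ∑ k ∈ Finset.range (n + 1), θ (n - k) * g ((k : ℝ) * t / n))
      Filter.atTop (nhds ((∑' k, θ k) * g t)) := by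
  obtain ⟨M, hM⟩ := isCompact_Icc.exists_bound_of_continuousOn hg
  have hM0 : 0 ≤ M := (norm_nonneg _).trans (hM 0 ⟨le_rfl, ht⟩)
  have hmem : ∀ n j : ℕ, ((n - j : ℕ) : ℝ) * t / n ∈ Set.Icc 0 t := fun n j => by
    refine ⟨by positivity, div_le_of_le_mul₀ (by positivity) ht ?_⟩
    rw [mul_comm t]
    gcongr
    exact Nat.sub_le n j
  set F : ℕ → ℕ → ℝ := fun n j =>
    if j ∈ Finset.range (n + 1) then θ j * g (((n - j : ℕ) : ℝ) * t / n) else 0 with hF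
  have hpoint : ∀ j, Filter.Tendsto (fun n => F n j) Filter.atTop (nhds (θ j * g t)) := by
    intro j
    have hnode : Filter.Tendsto (fun n : ℕ => ((n - j : ℕ) : ℝ) * t / n) Filter.atTop
        (nhds t) := by
      have h : Filter.Tendsto (fun n : ℕ => t - (j * t) / (n : ℝ)) Filter.atTop
          (nhds (t - 0)) :=
        tendsto_const_nhds.sub (tendsto_const_div_atTop_nhds_zero_nat _)
      rw [sub_zero] at h
      refine h.congr' ?_
      filter_upwards [Filter.eventually_ge_atTop (j + 1)] with n hn
      have hn0 : (n : ℝ) ≠ 0 := by exact_mod_cast (by omega : n ≠ 0)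
      rw [Nat.cast_sub (by omega)]
      field_simp
    have hlim : Filter.Tendsto (fun n : ℕ => g (((n - j : ℕ) : ℝ) * t / n)) Filter.atTop
        (nhds (g t)) :=
      (hg t ⟨ht, le_rfl⟩).tendsto.comp
        (tendsto_nhdsWithin_iff.mpr ⟨hnode, Filter.Eventually.of_forall fun n => hmem n j⟩)
    refine (hlim.const_mul (θ j)).congr' ?_
    filter_upwards [Filter.eventually_ge_atTop j] with n hn
    rw [hF]
    exact (if_pos (Finset.mem_range.mpr (Nat.lt_succ_of_le hn))).symm
  have hbound : ∀ n j, ‖F n j‖ ≤ |θ j| * M := by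
    intro n j
    by_cases hj : j ∈ Finset.range (n + 1)
    · simp only [hF, if_pos hj, norm_mul, Real.norm_eq_abs]
      exact mul_le_mul_of_nonneg_left (hM _ (hmem n j)) (abs_nonneg _)
    · simp only [hF, if_neg hj, norm_zero]
      positivity
  have hdom := tendsto_tsum_of_dominated_convergence (hθ.mul_right M) hpoint
    (Filter.Eventually.of_forall hbound)
  rw [tsum_mul_right] at hdom
  refine hdom.congr fun n => ?_
  rw [tsum_eq_sum (s := Finset.range (n + 1)) fun j hj => if_neg hj,
    ← Finset.sum_range_reflect]
  refine Finset.sum_congr rfl fun k hk => ?_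
  have hk' : k ≤ n := Nat.le_of_lt_succ (Finset.mem_range.mp hk)
  simp only [Nat.add_sub_cancel, Nat.sub_sub_self hk']
  exact if_pos (Finset.mem_range.mpr (Nat.lt_succ_of_le (Nat.sub_le n k)))

/-- For `1 < β < 2`, `θ_k = 2^{−β} binom(β,k)`, `t > 0` and `g` continuously
differentiable, `lim_{n→∞} ∑_{k=0}^n θ_{n−k} g(kt/n) = g(t)`. -/
theorem stmt_9 (β t : ℝ) (hβ1 : 1 < β) (hβ2 : β < 2) (ht : 0 < t)
    (g : ℝ → ℝ) (hg : ContDiff ℝ 1 g) :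
    Filter.Tendsto
      (fun n : ℕ =>
        ∑ k ∈ Finset.range (n + 1), 2 ^ (-β) * gbinom β (n - k) * g ((k : ℝ) * t / n))
      Filter.atTop (nhds (g t)) := by
  have hβ : 0 < β := by linarith
  have hsummable : Summable fun k => |2 ^ (-β) * gbinom β k| := by
    simpa only [abs_mul] using (summable_abs_gbinom hβ).mul_left |(2 : ℝ) ^ (-β)|
  have h := tendsto_sum_range_reflect_mul hsummable ht.le hg.continuous.continuousOn
  rwa [tsum_mul_left, tsum_gbinom hβ, ← Real.rpow_add two_pos, neg_add_cancel,
    Real.rpow_zero, one_mul] at h
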